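/- For every prime power q with q ≥ 7, the finite simple group PSL₃(F_q) is a characteristic quotient of F₂; that is, there exists a characteristic subgroup N of F₂ with F₂/N isomorphic to PSL₃(F_q). -/

import Mathlib

/-- `G` is a characteristic quotient of the free group `F₂` on two generators:
there is a characteristic subgroup `N ≤ F₂` with `F₂/N ≅ G`; equivalently, there is a
surjective homomorphism `F₂ → G` whose kernel is a characteristic subgroup. -/
def IsCharacteristicQuotientOfF2 (G : Type*) [Group G] : Prop :=
  ∃ φ : FreeGroup (Fin 2) →* G, Function.Surjective φ ∧ (MonoidHom.ker φ).Characteristic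

namespace List

/-- The length of the longest common prefix of two lists. -/
def lcpLength {β : Type*} [DecidableEq β] : List β → List β → ℕ
  | a :: l, b :: m => if a = b then lcpLength l m + 1 else 0
  | _, _ => 0

variable {β : Type*} [DecidableEq β]

theorem lcpLength_nil_left (l : List β) : lcpLength [] l = 0 := by
  simp [lcpLength]

theorem lcpLength_nil_right (l : List β) : lcpLength l [] = 0 := by
  cases l <;> simp [lcpLength]

theorem lcpLength_cons_cons (a b : β) (l m : List β) :
    lcpLength (a :: l) (b :: m) = if a = b then lcpLength l m + 1 else 0 := by
  simp [lcpLength]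

theorem lcpLength_comm (l m : List β) : lcpLength l m = lcpLength m l := by
  induction l generalizing m with
  | nil => simp [lcpLength_nil_left, lcpLength_nil_right]
  | cons a l ih =>
    cases m with
    | nil => simp [lcpLength_nil_left, lcpLength_nil_right]
    | cons b m => simp [lcpLength_cons_cons, ih m, eq_comm]

theorem min_lcpLength_le (l m n : List β) :
    min (lcpLength l m) (lcpLength m n) ≤ lcpLength l n := by
  induction l generalizing m n with
  | nil => simp [lcpLength_nil_left]
  | cons a l ih =>
    cases m with
    | nil => simp [lcpLength_nil_right]
    | cons b m =>
      cases n with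
      | nil => simp [lcpLength_nil_right]
      | cons c n =>
        have := ih m n
        simp only [lcpLength_cons_cons]
        split_ifs <;> first | omega | simp_all

end List

namespace FreeGroup

variable {α : Type*} [DecidableEq α]

theorem IsReduced.invRev {L : List (α × Bool)} (h : IsReduced L) :
    IsReduced (FreeGroup.invRev L) := by
  rw [isReduced_iff_reduce_eq, reduce_invRev, h.reduce_eq]

theorem length_reduce_invRev_append {L M : List (α × Bool)} (hL : IsReduced L)
    (hM : IsReduced M) :
    (reduce (invRev L ++ M)).length + 2 * L.lcpLength M = L.length + M.length := by
  induction L generalizing M with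
  | nil => simp [List.lcpLength_nil_left, hM.reduce_eq]
  | cons a L ih =>
    cases M with
    | nil => simp [List.lcpLength_nil_right, hL.invRev.reduce_eq]
    | cons b M =>
      rw [List.lcpLength_cons_cons]
      split_ifs with hab
      · subst hab
        have hL' : IsReduced L := List.IsChain.tail hL
        have hM' : IsReduced M := List.IsChain.tail hM
        have h := ih hL' hM'
        have : reduce (invRev (a :: L) ++ a :: M) = reduce (invRev L ++ M) := by
          apply reduce.sound
          rw [← mul_mk, ← mul_mk, ← inv_mk, ← inv_mk, ← List.singleton_append (l := L),
            ← List.singleton_append (l := M), ← mul_mk, ← mul_mk]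
          group
        rw [this]
        simp only [List.length_cons]
        omega
      · have : IsReduced (invRev (a :: L) ++ b :: M) := by
          refine List.IsChain.append hL.invRev hM ?_
          intro x hx y hy
          simp only [FreeGroup.invRev, List.map_cons, List.reverse_cons, List.getLast?_append,
            List.getLast?_singleton, Option.some_or, Option.mem_def, List.head?_cons,
            Option.some.injEq] at hx hy
          subst hx hy
          obtain ⟨a1, a2⟩ := a
          obtain ⟨b1, b2⟩ := b
          simp only [Prod.mk.injEq, not_and] at hab ⊢
          intro h
          have := hab h
          cases a2 <;> cases b2 <;> simp_all
        rw [this.reduce_eq]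
        simp

/-- The length of the longest common prefix of the reduced words of `x` and `y`. -/
def overlap (x y : FreeGroup α) : ℕ := x.toWord.lcpLength y.toWord

theorem norm_inv_mul_add (x y : FreeGroup α) :
    norm (x⁻¹ * y) + 2 * overlap x y = norm x + norm y := by
  unfold norm overlap
  rw [toWord_mul, toWord_inv, length_reduce_invRev_append isReduced_toWord isReduced_toWord]

theorem norm_mul_add (x y : FreeGroup α) :
    norm (x * y) + 2 * overlap x⁻¹ y = norm x + norm y := by
  simpa using norm_inv_mul_add x⁻¹ y

theorem overlap_comm (x y : FreeGroup α) : overlap x y = overlap y x :=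
  List.lcpLength_comm _ _

theorem min_overlap_le (x y z : FreeGroup α) :
    min (overlap x y) (overlap y z) ≤ overlap x z :=
  List.min_lcpLength_le _ _ _

theorem norm_lt_norm_mul_self {x : FreeGroup α} (hx : x ≠ 1) : norm x < norm (x * x) := by
  have h (n : ℕ) : norm (x ^ (n + 1)) = 2 * (reduceCyclically.conjugator x.toWord).length +
      (n + 1) * (reduceCyclically x.toWord).length := by
    rw [norm, toWord_pow, reduceCyclically.reduce_flatten_replicate_succ isReduced_toWord]
    simp
    ring
  have h1 := h 0
  have h2 := h 1
  rw [zero_add, pow_one] at h1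
  rw [pow_succ, pow_one] at h2
  have hne : (reduceCyclically x.toWord).length ≠ 0 := by
    intro h0
    rw [List.length_eq_zero_iff] at h0
    have := reduceCyclically.conj_conjugator_reduceCyclically x.toWord
    rw [h0] at this
    apply hx
    rw [← mk_toWord (x := x), ← this, List.append_nil, ← mul_mk, ← inv_mk, mul_inv_cancel]
  omega

theorem two_mul_overlap_inv_self_lt {x : FreeGroup α} (hx : x ≠ 1) :
    2 * overlap x⁻¹ x < norm x := by
  have := norm_lt_norm_mul_self hx
  have := norm_mul_add x x
  omega

theorem exists_norm_eq_one_overlap_eq_one {x : FreeGroup α} (hx : x ≠ 1) :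
    ∃ l : FreeGroup α, norm l = 1 ∧ overlap l x = 1 := by
  obtain ⟨a, L, h⟩ := List.exists_cons_of_ne_nil (mt toWord_eq_nil_iff.1 hx)
  refine ⟨mk [a], by simp [norm], ?_⟩
  simp [overlap, h, List.lcpLength_cons_cons, List.lcpLength_nil_left]

end FreeGroup

namespace FreeGroup

variable {α : Type*} [DecidableEq α]

/-- The image in `G` of a signed letter, given the images of the unsigned ones. -/
def letter {ι G : Type*} [Group G] (f : ι → G) (p : ι × Bool) : G :=
  cond p.2 (f p.1) (f p.1)⁻¹

theorem lift_mk_cons {ι G : Type*} [Group G] (f : ι → G) (p : ι × Bool) (L : List (ι × Bool)) :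
    lift f (mk (p :: L)) = letter f p * lift f (mk L) := by
  simp [letter]

/-- A Nielsen reduced family of elements: in a reduced word in these elements, at most half of
each letter is cancelled by either neighbour, and no letter is entirely cancelled by its two
neighbours. -/
structure IsNielsenReduced {ι : Type*} (f : ι → FreeGroup α) : Prop where
  two_mul_overlap_le : ∀ p q : ι × Bool, (p.1 = q.1 → p.2 = q.2) →
    2 * overlap (letter f p)⁻¹ (letter f q) ≤ norm (letter f p) ∧
    2 * overlap (letter f p)⁻¹ (letter f q) ≤ norm (letter f q)
  overlap_add_overlap_lt : ∀ p q r : ι × Bool, (p.1 = q.1 → p.2 = q.2) →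
    (q.1 = r.1 → q.2 = r.2) →
    overlap (letter f p)⁻¹ (letter f q) + overlap (letter f q)⁻¹ (letter f r) < norm (letter f q)

theorem IsNielsenReduced.overlap_lift_and_norm_le {ι : Type*} {f : ι → FreeGroup α}
    (hf : IsNielsenReduced f) (p : ι × Bool) (L : List (ι × Bool)) (hL : IsReduced (p :: L)) :
    (∀ r : ι × Bool, (r.1 = p.1 → r.2 = p.2) →
      overlap (letter f r)⁻¹ (FreeGroup.lift f (FreeGroup.mk (p :: L))) =
        overlap (letter f r)⁻¹ (letter f p)) ∧
    ∀ q ∈ p :: L, norm (letter f q) ≤ norm (FreeGroup.lift f (FreeGroup.mk (p :: L))) := by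
  induction L generalizing p with
  | nil =>
    have : lift f (FreeGroup.mk [p]) = letter f p := by rw [lift_mk_cons, ← one_eq_mk]; simp
    rw [this]
    simp
  | cons q L ih =>
    rw [isReduced_cons_cons] at hL
    obtain ⟨ih1, ih2⟩ := ih q hL.2
    rw [lift_mk_cons]
    set w := lift f (FreeGroup.mk (q :: L)) with hw
    have hpq := ih1 p hL.1
    have hnorm := norm_mul_add (letter f p) w
    have hq := ih2 q (by simp)
    have hle := hf.two_mul_overlap_le p q hL.1
    refine ⟨fun r hr => ?_, ?_⟩
    · have h3 := hf.overlap_add_overlap_lt r p q hr hL.1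
      have h4 := norm_inv_mul_add (letter f p) (letter f p * w)
      rw [inv_mul_cancel_left] at h4
      have h5 := min_overlap_le (letter f r)⁻¹ (letter f p) (letter f p * w)
      have h6 := min_overlap_le (letter f r)⁻¹ (letter f p * w) (letter f p)
      rw [overlap_comm (letter f p * w)] at h6
      omega
    · intro s hs
      rcases List.mem_cons.1 hs with rfl | hs
      · omega
      · have := ih2 s hs
        omega

/-- A Nielsen reduced generating family contains only elements of length at most one, apart from
those that can be omitted. -/
theorem IsNielsenReduced.norm_le_of_mem_toWord {ι : Type*} [DecidableEq ι]
    {f : ι → FreeGroup α} (hf : IsNielsenReduced f) (w : FreeGroup ι) {p : ι × Bool}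
    (hp : p ∈ w.toWord) : norm (letter f p) ≤ norm (lift f w) := by
  obtain ⟨q, L, h⟩ := List.exists_cons_of_ne_nil (List.ne_nil_of_mem hp)
  have := (hf.overlap_lift_and_norm_le q L (h ▸ isReduced_toWord)).2 p (h ▸ hp)
  rwa [← h, mk_toWord] at this

theorem lift_mem_of_forall_mem {ι G : Type*} [Group G] {f : ι → G} {H : Subgroup G}
    (L : List (ι × Bool)) (h : ∀ p ∈ L, letter f p ∈ H) : lift f (mk L) ∈ H := by
  induction L with
  | nil => rw [← one_eq_mk, _root_.map_one]; exact H.one_mem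
  | cons p L ih =>
    rw [lift_mk_cons]
    exact H.mul_mem (h p (by simp)) (ih fun q hq => h q (by simp [hq]))

theorem not_forall_of_mem_zpowers (g : FreeGroup (Fin 2)) :
    ¬ ∀ i, of i ∈ Subgroup.zpowers g := by
  intro h
  obtain ⟨m, hm⟩ := h 0
  obtain ⟨n, hn⟩ := h 1
  simp only at hm hn
  have h01 : (of 0 * of 1 : FreeGroup (Fin 2)) = of 1 * of 0 := by
    rw [← hm, ← hn, ← zpow_add, ← zpow_add, add_comm]
  have := congrArg toWord h01
  revert this
  decide

theorem eq_of_or_of_inv {g : FreeGroup (Fin 2)} (h : norm g = 1) :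
    g = of 0 ∨ g = of 1 ∨ g = (of 0)⁻¹ ∨ g = (of 1)⁻¹ := by
  obtain ⟨⟨i, b⟩, hp⟩ := List.length_eq_one_iff.1 h
  have : g = mk [(i, b)] := by rw [← hp, mk_toWord]
  subst this
  fin_cases i <;> cases b <;> simp [of, inv_mk, invRev]

/-- A relation on pairs of elements which is stable under elementary Nielsen transformations and
under simultaneous conjugation. -/
structure IsNielsenStable {G : Type*} [Group G] (B : G → G → Prop) : Prop where
  swap : ∀ u v, B u v → B v u
  inv : ∀ u v, B u v → B u⁻¹ v
  mul : ∀ u v, B u v → B u (v * u)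
  conj : ∀ g u v, B u v → B (g⁻¹ * u * g) (g⁻¹ * v * g)

namespace IsNielsenStable

variable {G : Type*} [Group G] {B : G → G → Prop} (hB : IsNielsenStable B)
include hB

theorem inv_right (u v : G) (h : B u v) : B u v⁻¹ :=
  hB.swap _ _ (hB.inv _ _ (hB.swap _ _ h))

theorem mul_left (u v : G) (h : B u v) : B (u * v) v :=
  hB.swap _ _ (hB.mul _ _ (hB.swap _ _ h))

end IsNielsenStable

section Minimal

variable {B : FreeGroup (Fin 2) → FreeGroup (Fin 2) → Prop}

theorem norm_le_norm_mul_of_minimal (hB : IsNielsenStable B) {u v : FreeGroup (Fin 2)}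
    (h : B u v) (hmin : ∀ u' v', B u' v' → norm u + norm v ≤ norm u' + norm v') :
    norm u ≤ norm (u * v) ∧ norm v ≤ norm (u * v) := by
  have h1 := hmin _ _ (hB.mul_left u v h)
  have h2 := hmin _ _ (hB.mul _ _ (hB.inv _ _ (hB.inv_right _ _ h)))
  rw [← mul_inv_rev] at h2
  simp only [norm_inv_eq] at h2
  omega

theorem overlap_lt_of_minimal (hB : IsNielsenStable B) {d b : FreeGroup (Fin 2)}
    (h : B d b) (hmin : ∀ u' v', B u' v' → norm d + norm b ≤ norm u' + norm v') (hb : b ≠ 1) :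
    ¬ (2 * overlap d⁻¹ b = norm b ∧ 2 * overlap b⁻¹ d = norm b) := by
  rintro ⟨h1, h2⟩
  have hb0 : norm b ≠ 0 := fun h0 => hb (norm_eq_zero.1 h0)
  obtain ⟨l, hl, hlb⟩ := exists_norm_eq_one_overlap_eq_one (x := b⁻¹) (inv_ne_one.2 hb)
  have hmul := norm_le_norm_mul_of_minimal hB h hmin
  have hconj := hmin _ _ (hB.conj l _ _ (hB.mul_left _ _ h))
  have hdb := norm_mul_add d b
  set e := d * b with he
  have h3 := min_overlap_le l b⁻¹ d
  have h4 := norm_inv_mul_add e⁻¹ b⁻¹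
  have h4' : norm (e⁻¹⁻¹ * b⁻¹) = norm d := by simp [he]
  have h5 := min_overlap_le l b⁻¹ e⁻¹
  have h6 := norm_inv_mul_add d e
  have h6' : norm (d⁻¹ * e) = norm b := by simp [he]
  have h7 := min_overlap_le l d e
  simp only [norm_inv_eq] at h4
  rw [overlap_comm] at h4
  have h8 := norm_inv_mul_add l e
  have h9 := norm_mul_add (l⁻¹ * e) l
  have h10 := min_overlap_le (l⁻¹ * e)⁻¹ e⁻¹ l
  have h11 := norm_inv_mul_add (l⁻¹ * e)⁻¹ e⁻¹
  have h11' : norm ((l⁻¹ * e)⁻¹⁻¹ * e⁻¹) = norm l := by simp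
  simp only [norm_inv_eq] at h11
  rw [overlap_comm e⁻¹ l] at h10
  have h12 := norm_inv_mul_add l b
  have h13 := norm_mul_add (l⁻¹ * b) l
  have h14 := min_overlap_le (l⁻¹ * b)⁻¹ b⁻¹ l
  have h15 := norm_inv_mul_add (l⁻¹ * b)⁻¹ b⁻¹
  have h15' : norm ((l⁻¹ * b)⁻¹⁻¹ * b⁻¹) = norm l := by simp
  simp only [norm_inv_eq] at h15
  rw [overlap_comm b⁻¹ l] at h14
  omega

end Minimal

/-- **Nielsen's theorem** in rank two: every generating pair of the free group on two generators
is reduced to the standard one by elementary Nielsen transformations and conjugation. -/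
theorem IsNielsenStable.of_zero_of_one {B : FreeGroup (Fin 2) → FreeGroup (Fin 2) → Prop}
    (hB : IsNielsenStable B) (hgen : ∀ u v, B u v → Function.Surjective (lift ![u, v]))
    {u v : FreeGroup (Fin 2)} (h : B u v) : B (of 0) (of 1) := by
  obtain ⟨⟨u, v⟩, h, hmin⟩ : ∃ p : FreeGroup (Fin 2) × FreeGroup (Fin 2), B p.1 p.2 ∧
      ∀ u' v', B u' v' → norm p.1 + norm p.2 ≤ norm u' + norm v' := by
    obtain ⟨p, hp, hmin⟩ := exists_minimalFor_of_wellFoundedLT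
      (fun p : FreeGroup (Fin 2) × FreeGroup (Fin 2) => B p.1 p.2)
      (fun p => norm p.1 + norm p.2) ⟨(u, v), h⟩
    refine ⟨p, hp, fun u' v' h' => ?_⟩
    have := @hmin (u', v') h'
    simp only at this
    omega
  simp only at h hmin
  set f : Fin 2 → FreeGroup (Fin 2) := ![u, v] with hf
  have hsurj := hgen u v h
  have hcyc (i j : Fin 2) (hij : i ≠ j) (hi : f i ∈ Subgroup.zpowers (f j)) : False := by
    apply not_forall_of_mem_zpowers (f j)
    intro k
    obtain ⟨w, hw⟩ := hsurj (of k)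
    rw [← hw, ← mk_toWord (x := w)]
    apply lift_mem_of_forall_mem
    rintro ⟨m, b⟩ -
    have hm : f m ∈ Subgroup.zpowers (f j) := by
      by_cases hmj : m = j
      · rw [hmj]; exact Subgroup.mem_zpowers _
      · have : m = i := by omega
        rwa [this]
    cases b
    · exact inv_mem hm
    · exact hm
  have hne (p : Fin 2 × Bool) : letter f p ≠ 1 := by
    intro h1
    have h0 : f p.1 = 1 := by
      rcases p with ⟨i, b⟩
      cases b <;> simpa [letter] using h1
    refine hcyc p.1 (p.1 + 1) (by have := p.1; grind) ?_
    rw [h0]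
    exact one_mem _
  have hBl (p q : Fin 2 × Bool) (hpq : p.1 ≠ q.1) : B (letter f p) (letter f q) ∧
      norm (letter f p) + norm (letter f q) = norm u + norm v := by
    obtain ⟨i, b⟩ := p
    obtain ⟨j, b'⟩ := q
    have h1 := hB.inv _ _ h
    have h2 := hB.inv_right _ _ h
    have h3 := hB.inv_right _ _ h1
    have h' := hB.swap _ _ h
    have h1' := hB.swap _ _ h1
    have h2' := hB.swap _ _ h2
    have h3' := hB.swap _ _ h3
    fin_cases i <;> fin_cases j <;> cases b <;> cases b' <;>
      simp_all [letter, add_comm]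
  have hred : IsNielsenReduced f := by
    have key (p q : Fin 2 × Bool) (hpq : p.1 = q.1 → p.2 = q.2) :
        2 * overlap (letter f p)⁻¹ (letter f q) ≤ norm (letter f p) ∧
        2 * overlap (letter f p)⁻¹ (letter f q) ≤ norm (letter f q) := by
      by_cases h1 : p.1 = q.1
      · have : p = q := Prod.ext h1 (hpq h1)
        subst this
        have := two_mul_overlap_inv_self_lt (hne p)
        omega
      · obtain ⟨h2, h3⟩ := hBl p q h1
        have h4 := norm_le_norm_mul_of_minimal hB h2 (by rw [h3]; exact hmin)
        have h5 := norm_mul_add (letter f p) (letter f q)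
        omega
    refine ⟨key, fun p q r hpq hqr => ?_⟩
    have k1 := key p q hpq
    have k2 := key q r hqr
    have hq := two_mul_overlap_inv_self_lt (hne q)
    by_cases h1 : p.1 = q.1
    · have : p = q := Prod.ext h1 (hpq h1)
      subst this
      omega
    by_cases h2 : q.1 = r.1
    · have : q = r := Prod.ext h2 (hqr h2)
      subst this
      omega
    have h3 : p.1 = r.1 := by omega
    by_cases h4 : p.2 = r.2
    · have : p = r := Prod.ext h3 h4
      subst this
      obtain ⟨h5, h6⟩ := hBl p q h1
      have := overlap_lt_of_minimal hB h5 (by rw [h6]; exact hmin) (hne q)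
      omega
    · have hinv : (letter f p)⁻¹ = letter f r := by
        obtain ⟨i, b⟩ := p
        obtain ⟨j, b'⟩ := r
        simp only at h3
        subst h3
        cases b <;> cases b' <;> simp_all [letter]
      have := min_overlap_le (letter f q)⁻¹ (letter f r) (letter f q)
      rw [hinv] at k1 ⊢
      omega
  have hnorm (i : Fin 2) : norm (f i) = 1 := by
    have h0 : norm (f i) ≠ 0 := fun h0 => hne (i, true) (norm_eq_zero.1 h0)
    by_contra h1
    apply not_forall_of_mem_zpowers (f (i + 1))
    intro k
    obtain ⟨w, hw⟩ := hsurj (of k)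
    rw [← hw, ← mk_toWord (x := w)]
    apply lift_mem_of_forall_mem
    rintro ⟨m, b⟩ hmem
    have h2 := hred.norm_le_of_mem_toWord w hmem
    rw [hw, norm_of] at h2
    have h3 : norm (f m) ≤ 1 := by cases b <;> simpa [letter] using h2
    have hm : m = i + 1 := by
      have hmi : m ≠ i := by rintro rfl; omega
      have aux : ∀ i m : Fin 2, m ≠ i → m = i + 1 := by decide
      exact aux i m hmi
    subst hm
    cases b
    · exact inv_mem (Subgroup.mem_zpowers _)
    · exact Subgroup.mem_zpowers _
  have hu := eq_of_or_of_inv (hnorm 0)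
  have hv := eq_of_or_of_inv (hnorm 1)
  have hc := hcyc 0 1 (by decide)
  have hinv := hB.inv
  have hinv' := hB.inv_right
  have hswap := hB.swap
  simp only [hf, Matrix.cons_val_zero, Matrix.cons_val_one] at hu hv hc
  rcases hu with rfl | rfl | rfl | rfl <;> rcases hv with rfl | rfl | rfl | rfl
  · exact absurd (Subgroup.mem_zpowers _) hc
  · exact h
  · exact absurd (by simp) hc
  · simpa using hinv' _ _ h
  · exact hswap _ _ h
  · exact absurd (Subgroup.mem_zpowers _) hc
  · simpa using hswap _ _ (hinv' _ _ h)
  · exact absurd (by simp) hc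
  · exact absurd (by simp) hc
  · simpa using hinv _ _ h
  · exact absurd (Subgroup.mem_zpowers _) hc
  · simpa using hinv _ _ (hinv' _ _ h)
  · simpa using hswap _ _ (hinv _ _ h)
  · exact absurd (by simp) hc
  · simpa using hswap _ _ (hinv _ _ (hinv' _ _ h))
  · exact absurd (Subgroup.mem_zpowers _) hc

end FreeGroup

namespace FreeGroup

theorem surjective_lift_of_mem_range {G : Type*} [Group G] {a b c d : G}
    (h : Function.Surjective (lift ![a, b])) (ha : a ∈ (lift ![c, d]).range)
    (hb : b ∈ (lift ![c, d]).range) : Function.Surjective (lift ![c, d]) := by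
  rw [← MonoidHom.range_eq_top] at h ⊢
  rw [eq_top_iff, ← h, range_lift_eq_closure, Subgroup.closure_le]
  rintro _ ⟨i, rfl⟩
  fin_cases i
  exacts [ha, hb]

theorem left_mem_range_lift {G : Type*} [Group G] (a b : G) : a ∈ (lift ![a, b]).range :=
  ⟨of 0, by simp⟩

theorem right_mem_range_lift {G : Type*} [Group G] (a b : G) : b ∈ (lift ![a, b]).range :=
  ⟨of 1, by simp⟩

/-- If swapping a pair `(a, b)`, inverting `a`, and replacing `b` by `b * a⁻¹` are all induced by
automorphisms of `G`, then the relations satisfied by the pair form a characteristic subgroup. -/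
theorem ker_lift_characteristic {G : Type*} [Group G] (a b : G)
    (hswap : ∃ θ : MulAut G, θ a = b ∧ θ b = a)
    (hinv : ∃ θ : MulAut G, θ a = a⁻¹ ∧ θ b = b)
    (hmul : ∃ θ : MulAut G, θ a = a ∧ θ b = b * a⁻¹) :
    (lift ![a, b]).ker.Characteristic := by
  set φ := lift ![a, b] with hφ
  have hφ0 : φ (of 0) = a := by simp [hφ]
  have hφ1 : φ (of 1) = b := by simp [hφ]
  set B : FreeGroup (Fin 2) → FreeGroup (Fin 2) → Prop := fun u v =>
    Function.Surjective (lift ![u, v]) ∧ ¬ ∃ θ : MulAut G, θ a = φ u ∧ θ b = φ v with hBdef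
  have hB : IsNielsenStable B := by
    refine ⟨?_, ?_, ?_, ?_⟩
    · rintro u v ⟨hs, hR⟩
      refine ⟨surjective_lift_of_mem_range hs (right_mem_range_lift _ _)
        (left_mem_range_lift _ _), fun ⟨θ, h1, h2⟩ => hR ?_⟩
      obtain ⟨σ, h3, h4⟩ := hswap
      exact ⟨θ * σ, by simp [h3, h2], by simp [h4, h1]⟩
    · rintro u v ⟨hs, hR⟩
      refine ⟨surjective_lift_of_mem_range hs (by simpa using inv_mem (left_mem_range_lift u⁻¹ v))
        (right_mem_range_lift _ _), fun ⟨θ, h1, h2⟩ => hR ?_⟩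
      obtain ⟨σ, h3, h4⟩ := hinv
      exact ⟨θ * σ, by simp [h3, h1], by simp [h4, h2]⟩
    · rintro u v ⟨hs, hR⟩
      have hv : v ∈ (lift ![u, v * u]).range := by
        have := mul_mem (right_mem_range_lift u (v * u)) (inv_mem (left_mem_range_lift u (v * u)))
        rwa [mul_inv_cancel_right] at this
      refine ⟨surjective_lift_of_mem_range hs (left_mem_range_lift _ _) hv,
        fun ⟨θ, h1, h2⟩ => hR ?_⟩
      obtain ⟨σ, h3, h4⟩ := hmul
      exact ⟨θ * σ, by simp [h3, h1], by simp [h4, h2, h1]⟩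
    · rintro g u v ⟨hs, hR⟩
      refine ⟨?_, fun ⟨θ, h1, h2⟩ => hR
        ⟨MulAut.conj (φ g) * θ, by simp [h1, mul_assoc], by simp [h2, mul_assoc]⟩⟩
      have : lift ![g⁻¹ * u * g, g⁻¹ * v * g] =
          (MulAut.conj g⁻¹).toMonoidHom.comp (lift ![u, v]) := by
        ext i
        fin_cases i <;> simp
      rw [this]
      exact (MulAut.conj g⁻¹).surjective.comp hs
  have key (α : FreeGroup (Fin 2) ≃* FreeGroup (Fin 2)) :
      ∃ θ : MulAut G, θ a = φ (α (of 0)) ∧ θ b = φ (α (of 1)) := by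
    by_contra hR
    refine (hB.of_zero_of_one (fun u v h => h.1) (u := α (of 0)) (v := α (of 1)) ⟨?_, hR⟩).2
      ⟨1, by simp [hφ0], by simp [hφ1]⟩
    have : lift ![α (of 0), α (of 1)] = α.toMonoidHom := by
      ext i
      fin_cases i <;> simp
    rw [this]
    exact α.surjective
  refine ⟨fun α => ?_⟩
  obtain ⟨θ, h0, h1⟩ := key α
  have h : θ.toMonoidHom.comp φ = φ.comp α.toMonoidHom := by
    ext i
    fin_cases i
    · simpa [hφ0] using h0
    · simpa [hφ1] using h1
  ext w
  have hw : θ (φ w) = φ (α w) := DFunLike.congr_fun h w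
  simp only [Subgroup.mem_comap, MonoidHom.mem_ker, MulEquiv.coe_toMonoidHom]
  rw [← hw, EmbeddingLike.map_eq_one_iff]

end FreeGroup

open scoped commutatorElement in
/-- A surjection with characteristic kernel still has characteristic kernel after dividing its
codomain by the center. -/
theorem MonoidHom.ker_mk_center_comp_characteristic {F G : Type*} [Group F] [Group G] (ψ : F →* G)
    (hψ : Function.Surjective ψ) (h : ψ.ker.Characteristic) :
    ((QuotientGroup.mk' (Subgroup.center G)).comp ψ).ker.Characteristic := by
  have mem (w : F) : w ∈ ((QuotientGroup.mk' (Subgroup.center G)).comp ψ).ker ↔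
      ∀ v : F, ⁅v, w⁆ ∈ ψ.ker := by
    rw [MonoidHom.mem_ker, MonoidHom.comp_apply, QuotientGroup.mk'_apply,
      QuotientGroup.eq_one_iff, Subgroup.mem_center_iff, hψ.forall]
    simp [MonoidHom.mem_ker, map_commutatorElement, commutatorElement_eq_one_iff_mul_comm]
  refine ⟨fun α => ?_⟩
  ext w
  rw [Subgroup.mem_comap, mem, mem, α.surjective.forall]
  refine forall_congr' fun v => ?_
  conv_rhs => rw [← h.fixed α, Subgroup.mem_comap]
  simp [map_commutatorElement]

namespace Matrix

variable {F : Type*} [Field F]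

/-- The automorphism of `GL n R` sending a matrix to the transpose of its inverse. -/
def contragredient {n R : Type*} [Fintype n] [DecidableEq n] [CommRing R] : MulAut (GL n R) where
  toFun g := ⟨(g⁻¹).valᵀ, g.valᵀ, by rw [← transpose_mul]; simp, by rw [← transpose_mul]; simp⟩
  invFun g := ⟨(g⁻¹).valᵀ, g.valᵀ, by rw [← transpose_mul]; simp, by rw [← transpose_mul]; simp⟩
  left_inv g := by ext; simp
  right_inv g := by ext; simp
  map_mul' g h := Units.ext (by simp [transpose_mul])

theorem conj_contragredient_apply_eq_iff {n R : Type*} [Fintype n] [DecidableEq n] [CommRing R]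
    (P g h : GL n R) : (MulAut.conj P⁻¹ * contragredient : MulAut (GL n R)) g = h ↔
      g.valᵀ * P.val * h.val = P.val := by
  have hT : g.valᵀ * (contragredient g).val = 1 := by
    simp only [contragredient, MulEquiv.coe_mk, Equiv.coe_fn_mk, ← transpose_mul]
    simp
  have hT' : (contragredient g).val * g.valᵀ = 1 := by
    simp only [contragredient, MulEquiv.coe_mk, Equiv.coe_fn_mk, ← transpose_mul]
    simp
  rw [MulAut.mul_apply, MulAut.conj_apply, inv_inv, mul_assoc, inv_mul_eq_iff_eq_mul,
    Units.ext_iff, Units.val_mul, Units.val_mul]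
  constructor <;> intro H
  · rw [mul_assoc, ← H, ← mul_assoc, hT, one_mul]
  · conv_lhs => rw [← H, mul_assoc g.valᵀ, ← mul_assoc, hT', one_mul]

/-- The first generator of the reduced Burau representation of the braid group on four strands,
with parameter `-c`. -/
def burau₁ (c : F) (hc : c ≠ 0) : GL (Fin 3) F where
  val := !![c, 1, 0; 0, 1, 0; 0, 0, 1]
  inv := !![c⁻¹, -c⁻¹, 0; 0, 1, 0; 0, 0, 1]
  val_inv := by ext i j; fin_cases i <;> fin_cases j <;> simp [mul_apply, Fin.sum_univ_three, hc]
  inv_val := by ext i j; fin_cases i <;> fin_cases j <;> simp [mul_apply, Fin.sum_univ_three, hc]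

/-- The second generator of the reduced Burau representation of the braid group on four strands,
with parameter `-c`. -/
def burau₂ (c : F) (hc : c ≠ 0) : GL (Fin 3) F where
  val := !![1, 0, 0; -c, c, 1; 0, 0, 1]
  inv := !![1, 0, 0; 1, c⁻¹, -c⁻¹; 0, 0, 1]
  val_inv := by ext i j; fin_cases i <;> fin_cases j <;> simp [mul_apply, Fin.sum_univ_three, hc]
  inv_val := by ext i j; fin_cases i <;> fin_cases j <;> simp [mul_apply, Fin.sum_univ_three, hc]

/-- The third generator of the reduced Burau representation of the braid group on four strands,
with parameter `-c`. -/
def burau₃ (c : F) (hc : c ≠ 0) : GL (Fin 3) F where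
  val := !![1, 0, 0; 0, 1, 0; 0, -c, c]
  inv := !![1, 0, 0; 0, 1, 0; 0, 1, c⁻¹]
  val_inv := by ext i j; fin_cases i <;> fin_cases j <;> simp [mul_apply, Fin.sum_univ_three, hc]
  inv_val := by ext i j; fin_cases i <;> fin_cases j <;> simp [mul_apply, Fin.sum_univ_three, hc]

section

variable (c : F) (hc : c ≠ 0)

/-- The image of the free generator `σ₁σ₃⁻¹` under the Burau representation. -/
def burauA : GL (Fin 3) F := burau₁ c hc * (burau₃ c hc)⁻¹

/-- The image of the free generator `σ₂σ₁σ₃⁻¹σ₂⁻¹` under the Burau representation. -/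
def burauB : GL (Fin 3) F := burau₂ c hc * burauA c hc * (burau₂ c hc)⁻¹

theorem burau₁_val : (burau₁ c hc).val = !![c, 1, 0; 0, 1, 0; 0, 0, 1] := rfl

theorem burau₂_val : (burau₂ c hc).val = !![1, 0, 0; -c, c, 1; 0, 0, 1] := rfl

theorem burau₃_val : (burau₃ c hc).val = !![1, 0, 0; 0, 1, 0; 0, -c, c] := rfl

theorem burau₁_inv_val : (burau₁ c hc)⁻¹.val = !![c⁻¹, -c⁻¹, 0; 0, 1, 0; 0, 0, 1] := rfl

theorem burau₂_inv_val : (burau₂ c hc)⁻¹.val = !![1, 0, 0; 1, c⁻¹, -c⁻¹; 0, 0, 1] := rfl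

theorem burau₃_inv_val : (burau₃ c hc)⁻¹.val = !![1, 0, 0; 0, 1, 0; 0, 1, c⁻¹] := rfl

theorem burauA_val : (burauA c hc).val = !![c, 1, 0; 0, 1, 0; 0, 1, c⁻¹] := by
  rw [burauA, Units.val_mul, burau₁_val, burau₃_inv_val]
  simp

theorem burauA_inv_val : (burauA c hc)⁻¹.val = !![c⁻¹, -c⁻¹, 0; 0, 1, 0; 0, -c, c] := by
  have : (burauA c hc)⁻¹ = burau₃ c hc * (burau₁ c hc)⁻¹ := by simp [burauA]
  rw [this, Units.val_mul, burau₁_inv_val, burau₃_val]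
  simp

theorem burauB_val : (burauB c hc).val =
    !![c + 1, c⁻¹, -c⁻¹; 1 - c ^ 2, c⁻¹, 0; 1, c⁻¹, 0] := by
  rw [burauB, Units.val_mul, Units.val_mul, burauA_val, burau₂_val, burau₂_inv_val]
  simp
  ring

theorem conj_burau₁_burauA : MulAut.conj (burau₁ c hc) (burauA c hc) = burauA c hc := by
  rw [MulAut.conj_apply, mul_inv_eq_iff_eq_mul, Units.ext_iff, Units.val_mul, Units.val_mul,
    burauA_val, burau₁_val]
  simp

theorem conj_burau₁_burauB :
    MulAut.conj (burau₁ c hc) (burauB c hc) = burauB c hc * (burauA c hc)⁻¹ := by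
  rw [MulAut.conj_apply, mul_inv_eq_iff_eq_mul, Units.ext_iff]
  simp only [Units.val_mul]
  rw [burauA_inv_val, burauB_val, burau₁_val]
  simp [hc]
  refine ⟨?_, ?_⟩ <;> field_simp <;> ring

/-- Conjugation by `σ₂σ₁σ₃` sends `a` to `b` and `b` to `a⁻¹`. -/
theorem conj_burau_rotation (c : F) (hc : c ≠ 0) :
    MulAut.conj (burau₂ c hc * burau₁ c hc * burau₃ c hc) (burauA c hc) = burauB c hc ∧
    MulAut.conj (burau₂ c hc * burau₁ c hc * burau₃ c hc) (burauB c hc) = (burauA c hc)⁻¹ := by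
  constructor <;> rw [MulAut.conj_apply, mul_inv_eq_iff_eq_mul, Units.ext_iff] <;>
    simp only [Units.val_mul]
  · rw [burauA_val, burauB_val, burau₁_val, burau₂_val, burau₃_val]
    simp [hc]
    refine ⟨?_, ?_⟩ <;> field_simp <;> ring_nf <;> simp
  · rw [burauA_inv_val, burauB_val, burau₁_val, burau₂_val, burau₃_val]
    simp [hc]
    refine ⟨?_, ?_⟩ <;> field_simp <;> ring_nf <;> simp

/-- Composing the contragredient with a suitable inner automorphism inverts `a` and fixes `b`. -/
theorem exists_mulAut_burau_inv (h1 : c ≠ 1) (h2 : c ^ 2 + 1 ≠ 0) : ∃ θ : MulAut (GL (Fin 3) F),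
    θ (burauA c hc) = (burauA c hc)⁻¹ ∧ θ (burauB c hc) = burauB c hc := by
  have hdet : det !![c ^ 2 * (c - 1), c ^ 2, 0; c ^ 2, -(c * (c - 1)), -c; 0, -c, c - 1] ≠ 0 := by
    rw [det_fin_three]
    simp
    intro h
    have : c ^ 3 * (c - 1) * (c ^ 2 + 1) = 0 := by linear_combination -h
    simp [hc, h2, sub_eq_zero, h1] at this
  set Q := GeneralLinearGroup.mkOfDetNeZero _ hdet
  have hQ : Q.val = !![c ^ 2 * (c - 1), c ^ 2, 0; c ^ 2, -(c * (c - 1)), -c; 0, -c, c - 1] := rfl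
  refine ⟨MulAut.conj (Q * burau₁ c hc * burau₃ c hc)⁻¹ * contragredient,
    (conj_contragredient_apply_eq_iff _ _ _).2 ?_, (conj_contragredient_apply_eq_iff _ _ _).2 ?_⟩
  · simp only [Units.val_mul]
    rw [burauA_inv_val, burauA_val, hQ, burau₁_val, burau₃_val]
    ext i j
    fin_cases i <;> fin_cases j <;> simp [mul_apply, Fin.sum_univ_three] <;> field_simp <;>
      ring_nf <;> simp
  · simp only [Units.val_mul]
    rw [burauB_val, hQ, burau₁_val, burau₃_val]
    ext i j
    fin_cases i <;> fin_cases j <;> simp [mul_apply, Fin.sum_univ_three] <;> field_simp <;>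
      ring_nf <;> simp

theorem ker_lift_burau_characteristic (h1 : c ≠ 1) (h2 : c ^ 2 + 1 ≠ 0) :
    (FreeGroup.lift ![burauA c hc, burauB c hc]).ker.Characteristic := by
  obtain ⟨θ, hA, hB⟩ := exists_mulAut_burau_inv c hc h1 h2
  obtain ⟨hA', hB'⟩ := conj_burau_rotation c hc
  refine FreeGroup.ker_lift_characteristic _ _
    ⟨θ * MulAut.conj (burau₂ c hc * burau₁ c hc * burau₃ c hc), ?_, ?_⟩ ⟨θ, hA, hB⟩
    ⟨MulAut.conj (burau₁ c hc), conj_burau₁_burauA c hc, conj_burau₁_burauB c hc⟩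
  · rw [MulAut.mul_apply, hA', hB]
  · rw [MulAut.mul_apply, hB', map_inv, hA, inv_inv]

end

end Matrix

namespace Subgroup

variable {R : Type*} [Monoid R]

/-- The elements of a monoid that are the values of units in a given group of units. -/
def unitsImage (K : Subgroup Rˣ) : Submonoid R := K.toSubmonoid.map (Units.coeHom R)

theorem val_mem_unitsImage {K : Subgroup Rˣ} {g : Rˣ} (hg : g ∈ K) : g.val ∈ K.unitsImage :=
  ⟨g, hg, rfl⟩

theorem mem_unitsImage_of_mul_eq {K : Subgroup Rˣ} {x y u : R} (hx : x ∈ K.unitsImage)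
    (hy : y ∈ K.unitsImage) (h : x = u * y) : u ∈ K.unitsImage := by
  obtain ⟨g, hg, rfl⟩ := hx
  obtain ⟨k, hk, rfl⟩ := hy
  exact ⟨g * k⁻¹, K.mul_mem hg (K.inv_mem hk), by simp_all⟩

theorem mem_unitsImage_of_eq_mul {K : Subgroup Rˣ} {x y u : R} (hx : x ∈ K.unitsImage)
    (hy : y ∈ K.unitsImage) (h : x = y * u) : u ∈ K.unitsImage := by
  obtain ⟨g, hg, rfl⟩ := hx
  obtain ⟨k, hk, rfl⟩ := hy
  exact ⟨k⁻¹ * g, K.mul_mem (K.inv_mem hk) hg, by simp_all⟩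

/-- The commutator of an element of `H` with an element of the normalizer of `H` lies in `H`. -/
theorem mem_unitsImage_of_commutator_left {H K : Subgroup Rˣ}
    (hK : K ≤ normalizer (H : Set Rˣ)) {x y u : R} (hx : x ∈ H.unitsImage)
    (hy : y ∈ K.unitsImage) (h : x * y = u * (y * x)) : u ∈ H.unitsImage := by
  obtain ⟨g, hg, rfl⟩ := hx
  obtain ⟨k, hk, rfl⟩ := hy
  refine ⟨g * (k * g⁻¹ * k⁻¹), H.mul_mem hg ((mem_normalizer_iff.1 (hK hk) _).1 (H.inv_mem hg)), ?_⟩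
  have : (g * k).val = u * (k * g).val := by simpa using h
  have hu : u = (g * k).val * ((k * g)⁻¹).val := by rw [this, Units.mul_inv_cancel_right]
  rw [hu, ← Units.val_mul]
  simp [mul_assoc]

theorem mem_unitsImage_of_commutator_right {H K : Subgroup Rˣ}
    (hK : K ≤ normalizer (H : Set Rˣ)) {x y u : R} (hx : x ∈ K.unitsImage)
    (hy : y ∈ H.unitsImage) (h : x * y = u * (y * x)) : u ∈ H.unitsImage := by
  obtain ⟨k, hk, rfl⟩ := hx
  obtain ⟨g, hg, rfl⟩ := hy
  refine ⟨k * g * k⁻¹ * g⁻¹, H.mul_mem ((mem_normalizer_iff.1 (hK hk) _).1 hg) (H.inv_mem hg), ?_⟩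
  have : (k * g).val = u * (g * k).val := by simpa using h
  have hu : u = (k * g).val * ((g * k)⁻¹).val := by rw [this, Units.mul_inv_cancel_right]
  rw [hu, ← Units.val_mul]
  simp [mul_assoc]

theorem mem_normalizer_closure_of_finite {G : Type*} [Group G] [Finite G] {s : Set G} {g : G}
    (h : ∀ x ∈ s, MulAut.conj g x ∈ closure s) : g ∈ normalizer (closure s : Set G) := by
  refine mem_normalizer_fintype (S := (closure s : Set G)) fun x hx => ?_
  have : closure s ≤ (closure s).comap (MulAut.conj g).toMonoidHom := by
    rw [closure_le]
    exact h
  exact this hx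

/-- If a group of units contains all homologies `1 + y • P` and `1 + y • Q` attached to two
idempotents `P` and `Q` in Burau position, then it contains the transvections `1 + t • N` with
`N = P * Q - k • P`. -/
theorem one_add_smul_mem_unitsImage {F R : Type*} [Field F] [Ring R] [Algebra F R]
    {K : Subgroup Rˣ} {P Q : R} {c k : F} (hk : k = -c / (c - 1) ^ 2)
    (hc : c ≠ 0) (h1 : c - 1 ≠ 0) (h1' : c + 1 ≠ 0) (h2 : c ^ 2 + 1 ≠ 0) (h3 : c ^ 3 - 1 ≠ 0)
    (hP : P * P = P) (hQ : Q * Q = Q) (hPQP : P * Q * P = k • P)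
    (hKP : ∀ y : F, 1 + y ≠ 0 → 1 + y • P ∈ K.unitsImage)
    (hKQ : ∀ y : F, 1 + y ≠ 0 → 1 + y • Q ∈ K.unitsImage) (t : F) :
    1 + t • (P * Q - k • P) ∈ K.unitsImage := by
  set N := P * Q - k • P with hN
  have hPN : P * N = N := by simp [hN, mul_sub, ← mul_assoc, hP]
  have hNP : N * P = 0 := by simp [hN, sub_mul, hPQP, hP]
  have hNN : N * N = 0 := by rw [← hPN, ← mul_assoc, mul_assoc P, hNP, mul_zero, zero_mul]
  set x := (c ^ 3 - 1) / (c + 1) with hx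
  set θ := -c ^ 2 / (c + 1) with hθ
  set β := c * (c - 1) * (1 - c ^ 3) / (c + 1) with hβ
  have hθ0 : θ ≠ 0 := by simp [hθ, hc, h1']
  have hβ0 : β ≠ 0 := by
    have : 1 - c ^ 3 ≠ 0 := by rw [← neg_sub]; exact neg_ne_zero.2 h3
    simp [hβ, hc, h1', this, h1]
  set g := (1 + (c ^ 2 - 1) • Q) * (1 + x • P) * (1 + (c - 1) • Q) with hg
  have hgK : g ∈ K.unitsImage := by
    refine mul_mem (mul_mem (hKQ _ ?_) (hKP _ ?_)) (hKQ _ ?_)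
    · simp [hc]
    · have : 1 + x = c * (c ^ 2 + 1) / (c + 1) := by rw [hx]; field_simp; ring
      simp [this, hc, h1', h2]
    · simp [hc]
  have hgP : g * P = θ • P := by
    have e1 : (1 + (c - 1) • Q) * P = P + (c - 1) • (Q * P) := by simp [add_mul]
    have e2 : (1 + x • P) * (P + (c - 1) • (Q * P)) = θ • P + (c - 1) • (Q * P) := by
      have : 1 + x + x * (c - 1) * k = θ := by rw [hk, hx, hθ]; field_simp; ring
      rw [← this, add_mul, one_mul, smul_mul_assoc, mul_add, hP, mul_smul_comm, ← mul_assoc, hPQP]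
      module
    have e3 : (1 + (c ^ 2 - 1) • Q) * (θ • P + (c - 1) • (Q * P)) = θ • P := by
      have : c - 1 + (c ^ 2 - 1) * θ + (c - 1) * (c ^ 2 - 1) = 0 := by rw [hθ]; field_simp; ring
      rw [add_mul, one_mul, smul_mul_assoc, mul_add, mul_smul_comm, mul_smul_comm, ← mul_assoc, hQ]
      have h := congrArg (· • (Q * P)) this
      simp only [zero_smul] at h
      conv_rhs => rw [← add_zero (θ • P), ← h]
      module
    rw [hg, mul_assoc, e1, mul_assoc, e2, e3]
  have hPg : P * g = θ • P + β • N := by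
    have e1 : P * (1 + (c ^ 2 - 1) • Q) = P + (c ^ 2 - 1) • (P * Q) := by simp [mul_add]
    have e2 : (P + (c ^ 2 - 1) • (P * Q)) * (1 + x • P) =
        (1 + x + x * (c ^ 2 - 1) * k) • P + (c ^ 2 - 1) • (P * Q) := by
      rw [mul_add, mul_one, mul_smul_comm, add_mul, hP, smul_mul_assoc, hPQP]
      module
    have e3 : ((1 + x + x * (c ^ 2 - 1) * k) • P + (c ^ 2 - 1) • (P * Q)) *
        (1 + (c - 1) • Q) = θ • P + β • N := by
      have ha : (c - 1) * (1 + x + x * (c ^ 2 - 1) * k) + (c ^ 2 - 1) +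
          (c - 1) * (c ^ 2 - 1) = β := by
        rw [hk, hx, hβ]; field_simp; ring
      have hb : 1 + x + x * (c ^ 2 - 1) * k + k * β = θ := by
        rw [hk, hx, hβ, hθ]; field_simp; ring
      rw [← hb, ← ha, mul_add, mul_one, mul_smul_comm, add_mul, smul_mul_assoc, smul_mul_assoc,
        mul_assoc P, hQ, hN]
      module
    rw [hg, ← mul_assoc, ← mul_assoc, e1, e2, e3]
  have generic (t : F) (ht : 1 + t * θ / β ≠ 0) : 1 + t • N ∈ K.unitsImage := by
    have hD := hKP _ ht
    refine mem_unitsImage_of_eq_mul (mem_unitsImage_of_mul_eq (mul_mem hD hgK) hD ?_) hgK rfl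
    have hgN : g * N = θ • N := by rw [← hPN, ← mul_assoc, hgP, smul_mul_assoc]
    have : (t * θ / β) * β = t * θ := by field_simp
    simp only [add_mul, mul_add, one_mul, mul_one, smul_mul_assoc, mul_smul_comm, hPg, hgP, hgN,
      hNP, smul_zero, smul_add, smul_smul, this]
    module
  by_cases ht : 1 + t * θ / β = 0
  · have e : 1 + t • N = (1 + (c * t) • N) * (1 + ((1 - c) * t) • N) := by
      simp only [add_mul, mul_add, one_mul, mul_one, smul_mul_assoc, mul_smul_comm, hNN, smul_zero]
      module
    rw [e]
    refine mul_mem (generic _ fun h => h1 ?_) (generic _ fun h => hc ?_)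
    · linear_combination c * ht - h
    · linear_combination h - (1 - c) * ht
  · exact generic t ht

/-- The powers of a homology. -/
theorem one_add_smul_mem_unitsImage_of_isIdempotent {F R : Type*} [Field F] [Ring R] [Algebra F R]
    {K : Subgroup Rˣ} {P : R} {c : F} (hc : ∀ y : F, y ≠ 0 → ∃ n : ℕ, c ^ n = y)
    (hP : P * P = P) (h : 1 + (c - 1) • P ∈ K.unitsImage) (y : F) (hy : 1 + y ≠ 0) :
    1 + y • P ∈ K.unitsImage := by
  have hpow (n : ℕ) : (1 + (c - 1) • P) ^ n = 1 + (c ^ n - 1) • P := by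
    induction n with
    | zero => simp
    | succ n ih =>
      rw [pow_succ, ih, add_mul, mul_add, mul_add, smul_mul_smul_comm, hP]
      simp only [one_mul, mul_one]
      module
  obtain ⟨n, hn⟩ := hc _ hy
  have := pow_mem h n
  rwa [hpow, hn, add_sub_cancel_left] at this

end Subgroup

namespace Matrix

variable {F : Type*} [Field F]

theorem diagonal_mem_of_transvection_mem {S : Submonoid (Matrix (Fin 3) (Fin 3) F)}
    (h : ∀ i j, i ≠ j → ∀ t, transvection i j t ∈ S) (d : Fin 3 → F)
    (hd : d 0 * d 1 * d 2 = 1) : diagonal d ∈ S := by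
  have h0 : d 0 ≠ 0 := by rintro h; simp [h] at hd
  have h1 : d 1 ≠ 0 := by rintro h; simp [h] at hd
  have h2 : d 2 = (d 0 * d 1)⁻¹ := by field_simp; linear_combination hd
  have e : diagonal d =
      transvection 0 1 (d 0) * transvection 1 0 (-(d 0)⁻¹) * transvection 0 1 (d 0) *
      (transvection 0 1 (-1) * transvection 1 0 1 * transvection 0 1 (-1)) *
      (transvection 1 2 (d 0 * d 1) * transvection 2 1 (-(d 0 * d 1)⁻¹) *
        transvection 1 2 (d 0 * d 1) *
      (transvection 1 2 (-1) * transvection 2 1 1 * transvection 1 2 (-1))) := by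
    ext i j
    fin_cases i <;> fin_cases j <;>
      simp [transvection, mul_apply, Fin.sum_univ_three, single_apply, h2] <;> field_simp <;>
      ring_nf <;> simp
  rw [e]
  have h01 := h 0 1 (by decide)
  have h10 := h 1 0 (by decide)
  have h12 := h 1 2 (by decide)
  have h21 := h 2 1 (by decide)
  exact mul_mem (mul_mem (mul_mem (mul_mem (h01 _) (h10 _)) (h01 _))
    (mul_mem (mul_mem (h01 _) (h10 _)) (h01 _))) (mul_mem (mul_mem (mul_mem (h12 _) (h21 _))
    (h12 _)) (mul_mem (mul_mem (h12 _) (h21 _)) (h12 _)))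

theorem mem_of_transvection_mem_of_det_eq_one {S : Submonoid (Matrix (Fin 3) (Fin 3) F)}
    (h : ∀ i j, i ≠ j → ∀ t, transvection i j t ∈ S) (M : Matrix (Fin 3) (Fin 3) F)
    (hM : M.det = 1) : M ∈ S := by
  obtain ⟨L, L', D, hLD⟩ := Pivot.exists_list_transvec_mul_diagonal_mul_list_transvec M
  have hL (L : List (TransvectionStruct (Fin 3) F)) :
      (L.map TransvectionStruct.toMatrix).prod ∈ S := by
    refine list_prod_mem fun x hx => ?_
    obtain ⟨t, -, rfl⟩ := List.mem_map.1 hx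
    exact h _ _ t.hij _
  rw [hLD]
  refine mul_mem (mul_mem (hL L) (diagonal_mem_of_transvection_mem h D ?_)) (hL L')
  rw [hLD, det_mul, det_mul, TransvectionStruct.det_toMatrix_prod,
    TransvectionStruct.det_toMatrix_prod, det_diagonal, Fin.prod_univ_three] at hM
  simpa using hM

theorem mem_of_elementary_mem_of_det_eq_one {S : Submonoid (Matrix (Fin 3) (Fin 3) F)}
    (h12 : ∀ t : F, !![1, t, 0; 0, 1, 0; 0, 0, 1] ∈ S)
    (h13 : ∀ t : F, !![1, 0, t; 0, 1, 0; 0, 0, 1] ∈ S)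
    (h21 : ∀ t : F, !![1, 0, 0; t, 1, 0; 0, 0, 1] ∈ S)
    (h23 : ∀ t : F, !![1, 0, 0; 0, 1, t; 0, 0, 1] ∈ S)
    (h31 : ∀ t : F, !![1, 0, 0; 0, 1, 0; t, 0, 1] ∈ S)
    (h32 : ∀ t : F, !![1, 0, 0; 0, 1, 0; 0, t, 1] ∈ S)
    (M : Matrix (Fin 3) (Fin 3) F) (hM : M.det = 1) : M ∈ S := by
  refine mem_of_transvection_mem_of_det_eq_one (fun i j hij t => ?_) M hM
  fin_cases i <;> fin_cases j <;> first | exact absurd rfl hij | skip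
  · convert h12 t
    ext i j; fin_cases i <;> fin_cases j <;> simp [transvection]
  · convert h13 t
    ext i j; fin_cases i <;> fin_cases j <;> simp [transvection]
  · convert h21 t
    ext i j; fin_cases i <;> fin_cases j <;> simp [transvection]
  · convert h23 t
    ext i j; fin_cases i <;> fin_cases j <;> simp [transvection]
  · convert h31 t
    ext i j; fin_cases i <;> fin_cases j <;> simp [transvection]
  · convert h32 t
    ext i j; fin_cases i <;> fin_cases j <;> simp [transvection]

end Matrix

namespace Matrix

open Subgroup

variable {F : Type*} [Field F] (c : F) (hc : c ≠ 0)

/-- The image of the braid group on four strands under the reduced Burau representation. -/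
def burauGroup : Subgroup (GL (Fin 3) F) := closure {burau₁ c hc, burau₂ c hc, burau₃ c hc}

/-- The image of the free group generated by `σ₁σ₃⁻¹` and `σ₂σ₁σ₃⁻¹σ₂⁻¹` under the reduced Burau
representation. -/
def burauFree : Subgroup (GL (Fin 3) F) := closure {burauA c hc, burauB c hc}

theorem burau₁_mem : !![c, 1, 0; 0, 1, 0; 0, 0, 1] ∈ (burauGroup c hc).unitsImage :=
  val_mem_unitsImage (subset_closure (by simp) : burau₁ c hc ∈ burauGroup c hc)

theorem burau₂_mem : !![1, 0, 0; -c, c, 1; 0, 0, 1] ∈ (burauGroup c hc).unitsImage :=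
  val_mem_unitsImage (subset_closure (by simp) : burau₂ c hc ∈ burauGroup c hc)

theorem burau₃_mem : !![1, 0, 0; 0, 1, 0; 0, -c, c] ∈ (burauGroup c hc).unitsImage :=
  val_mem_unitsImage (subset_closure (by simp) : burau₃ c hc ∈ burauGroup c hc)

theorem burauA_mem : !![c, 1, 0; 0, 1, 0; 0, 1, c⁻¹] ∈ (burauFree c hc).unitsImage := by
  rw [← burauA_val c hc]
  exact val_mem_unitsImage (subset_closure (by simp))

theorem burauGroup_le_normalizer [Finite F] :
    burauGroup c hc ≤ normalizer (burauFree c hc : Set (GL (Fin 3) F)) := by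
  have hA : burauA c hc ∈ burauFree c hc := subset_closure (by simp)
  have hB : burauB c hc ∈ burauFree c hc := subset_closure (by simp)
  have h2 : MulAut.conj (burau₂ c hc) (burauB c hc) =
      burauB c hc * (burauA c hc)⁻¹ * burauB c hc := by
    rw [MulAut.conj_apply, mul_inv_eq_iff_eq_mul, Units.ext_iff]
    simp only [Units.val_mul]
    rw [burauA_inv_val, burauB_val, burau₂_val]
    ext i j
    fin_cases i <;> fin_cases j <;> simp [mul_apply, Fin.sum_univ_three] <;> field_simp <;>
      ring_nf <;> simp
  have h3 : MulAut.conj (burau₃ c hc) (burauA c hc) = burauA c hc := by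
    rw [MulAut.conj_apply, mul_inv_eq_iff_eq_mul, Units.ext_iff]
    simp only [Units.val_mul]
    rw [burauA_val, burau₃_val]
    simp [hc]
  have h3' : MulAut.conj (burau₃ c hc) (burauB c hc) = (burauA c hc)⁻¹ * burauB c hc := by
    rw [MulAut.conj_apply, mul_inv_eq_iff_eq_mul, Units.ext_iff]
    simp only [Units.val_mul]
    rw [burauA_inv_val, burauB_val, burau₃_val]
    ext i j
    fin_cases i <;> fin_cases j <;> simp [mul_apply, Fin.sum_univ_three] <;> field_simp <;> ring
  rw [burauGroup, closure_le]
  rintro _ (rfl | rfl | rfl) <;> refine mem_normalizer_closure_of_finite ?_ <;>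
    rintro _ (rfl | rfl)
  · rwa [conj_burau₁_burauA]
  · rw [conj_burau₁_burauB]
    exact mul_mem hB (inv_mem hA)
  · exact hB
  · rw [h2]
    exact mul_mem (mul_mem hB (inv_mem hA)) hB
  · rwa [h3]
  · rw [h3']
    exact mul_mem (inv_mem hA) hB

/-- If the Burau group contains the elementary matrices with indices `13`, `31`, `21` and `23`,
then its free subgroup contains `SL₃`. -/
theorem mem_burauFree_of_elementary_mem [Finite F] (h1 : c - 1 ≠ 0) (h1' : c + 1 ≠ 0)
    (h13 : ∀ t : F, !![1, 0, t; 0, 1, 0; 0, 0, 1] ∈ (burauGroup c hc).unitsImage)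
    (h31 : ∀ t : F, !![1, 0, 0; 0, 1, 0; t, 0, 1] ∈ (burauGroup c hc).unitsImage)
    (h21 : ∀ t : F, !![1, 0, 0; t, 1, 0; 0, 0, 1] ∈ (burauGroup c hc).unitsImage)
    (h23 : ∀ t : F, !![1, 0, 0; 0, 1, t; 0, 0, 1] ∈ (burauGroup c hc).unitsImage)
    (M : Matrix (Fin 3) (Fin 3) F) (hM : M.det = 1) : M ∈ (burauFree c hc).unitsImage := by
  have hN := burauGroup_le_normalizer c hc
  have hA := burauA_mem c hc
  have hcc : c ^ 2 - 1 ≠ 0 := by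
    have : c ^ 2 - 1 = (c - 1) * (c + 1) := by ring
    simp [this, h1, h1']
  have hcc' : 1 - c ^ 2 ≠ 0 := by rw [← neg_sub]; exact neg_ne_zero.2 hcc
  have hc1 : 1 - c ≠ 0 := by rw [← neg_sub]; exact neg_ne_zero.2 h1
  have g12 (t : F) : !![1, t, 0; 0, 1, 0; 0, 0, 1] ∈ (burauGroup c hc).unitsImage := by
    have : !![1, t, c⁻¹ * t; 0, 1, 0; 0, 0, 1] ∈ (burauGroup c hc).unitsImage := by
      refine mem_unitsImage_of_mul_eq (mul_mem (burau₃_mem c hc) (h13 t)) (burau₃_mem c hc) ?_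
      ext i j
      fin_cases i <;> fin_cases j <;> simp [mul_apply, Fin.sum_univ_three] <;> field_simp <;> ring
    refine mem_unitsImage_of_mul_eq this (h13 (c⁻¹ * t)) ?_
    simp
  have g32 (t : F) : !![1, 0, 0; 0, 1, 0; 0, t, 1] ∈ (burauGroup c hc).unitsImage := by
    have : !![1, 0, 0; 0, 1, 0; -t, t, 1] ∈ (burauGroup c hc).unitsImage := by
      refine mem_unitsImage_of_mul_eq (mul_mem (burau₁_mem c hc) (h31 (-t * c)))
        (burau₁_mem c hc) ?_
      ext i j
      fin_cases i <;> fin_cases j <;> simp [mul_apply, Fin.sum_univ_three]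
    refine mem_unitsImage_of_mul_eq this (h31 (-t)) ?_
    simp
  have f12 (t : F) : !![1, t, 0; 0, 1, 0; 0, 0, 1] ∈ (burauFree c hc).unitsImage := by
    refine mem_unitsImage_of_commutator_left hN hA (g12 (t / (c - 1))) ?_
    ext i j
    fin_cases i <;> fin_cases j <;> simp [mul_apply, Fin.sum_univ_three] <;> field_simp <;> ring
  have f13 (t : F) : !![1, 0, t; 0, 1, 0; 0, 0, 1] ∈ (burauFree c hc).unitsImage := by
    have : !![1, -c ^ 2 * t / (c ^ 2 - 1), t; 0, 1, 0; 0, 0, 1] ∈ (burauFree c hc).unitsImage := by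
      refine mem_unitsImage_of_commutator_left hN hA (h13 (t / (c ^ 2 - 1))) ?_
      ext i j
      fin_cases i <;> fin_cases j <;> simp [mul_apply, Fin.sum_univ_three] <;> field_simp <;> ring
    refine mem_unitsImage_of_mul_eq this (f12 (-c ^ 2 * t / (c ^ 2 - 1))) ?_
    simp
  have f32 (t : F) : !![1, 0, 0; 0, 1, 0; 0, t, 1] ∈ (burauFree c hc).unitsImage := by
    refine mem_unitsImage_of_commutator_left hN hA (g32 (t * c / (1 - c))) ?_
    ext i j
    fin_cases i <;> fin_cases j <;> simp [mul_apply, Fin.sum_univ_three] <;> field_simp <;> ring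
  have f31 (t : F) : !![1, 0, 0; 0, 1, 0; t, 0, 1] ∈ (burauFree c hc).unitsImage := by
    have : !![1, 0, 0; 0, 1, 0; t, -t / (1 - c ^ 2), 1] ∈ (burauFree c hc).unitsImage := by
      refine mem_unitsImage_of_commutator_left hN hA (h31 (t * c ^ 2 / (1 - c ^ 2))) ?_
      ext i j
      fin_cases i <;> fin_cases j <;> simp [mul_apply, Fin.sum_univ_three] <;> field_simp <;> ring
    refine mem_unitsImage_of_mul_eq this (f32 (-t / (1 - c ^ 2))) ?_
    simp
  refine mem_of_elementary_mem_of_det_eq_one f12 f13 (fun t => ?_) (fun t => ?_) f31 f32 M hM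
  · refine mem_unitsImage_of_commutator_right hN (h23 t) (f31 1) ?_
    simp
  · refine mem_unitsImage_of_commutator_right hN (h21 t) (f13 1) ?_
    simp

end Matrix

namespace Matrix

open Subgroup

variable {F : Type*} [Field F] (c : F) (hc : c ≠ 0)

set_option maxHeartbeats 800000 in
/-- If `c` generates the multiplicative group and is not a root of unity of small order, then the
Burau group contains four families of transvections. -/
theorem burau_transvections_mem (hgen : ∀ y : F, y ≠ 0 → ∃ n : ℕ, c ^ n = y)
    (h1 : c - 1 ≠ 0) (h1' : c + 1 ≠ 0) (h2 : c ^ 2 + 1 ≠ 0) (h3 : c ^ 3 - 1 ≠ 0) :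
    (∀ t : F, !![1, t * (c ^ 2 - c + 1), t * (c - 1); 0, 1, 0; 0, 0, 1] ∈
      (burauGroup c hc).unitsImage) ∧
    (∀ t : F, !![1, 0, 0; t * (c ^ 2 - c + 1), 1, -t; 0, 0, 1] ∈
      (burauGroup c hc).unitsImage) ∧
    (∀ t : F, !![1, 0, 0; -t * c ^ 2, 1, t * (c ^ 2 - c + 1); 0, 0, 1] ∈
      (burauGroup c hc).unitsImage) ∧
    ∀ t : F, !![1, 0, 0; 0, 1, 0; -t * c * (c - 1), t * (c ^ 2 - c + 1), 1] ∈
      (burauGroup c hc).unitsImage := by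
  set Γ := burauGroup c hc
  set P₁ : Matrix (Fin 3) (Fin 3) F := !![1, 1 / (c - 1), 0; 0, 0, 0; 0, 0, 0] with hP₁
  set P₂ : Matrix (Fin 3) (Fin 3) F := !![0, 0, 0; -c / (c - 1), 1, 1 / (c - 1); 0, 0, 0] with hP₂
  set P₃ : Matrix (Fin 3) (Fin 3) F := !![0, 0, 0; 0, 0, 0; 0, -c / (c - 1), 1] with hP₃
  have hPP₁ : P₁ * P₁ = P₁ := by
    ext i j
    fin_cases i <;> fin_cases j <;> simp [hP₁]
  have hPP₂ : P₂ * P₂ = P₂ := by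
    ext i j
    fin_cases i <;> fin_cases j <;> simp [hP₂]
  have hPP₃ : P₃ * P₃ = P₃ := by
    ext i j
    fin_cases i <;> fin_cases j <;> simp [hP₃]
  have hom₁ := one_add_smul_mem_unitsImage_of_isIdempotent (K := Γ) hgen hPP₁ <| by
    convert burau₁_mem c hc using 1
    ext i j
    fin_cases i <;> fin_cases j <;> simp [hP₁, h1]
  have hom₂ := one_add_smul_mem_unitsImage_of_isIdempotent (K := Γ) hgen hPP₂ <| by
    convert burau₂_mem c hc using 1
    ext i j
    fin_cases i <;> fin_cases j <;> simp [hP₂, h1] <;> field_simp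
  have hom₃ := one_add_smul_mem_unitsImage_of_isIdempotent (K := Γ) hgen hPP₃ <| by
    convert burau₃_mem c hc using 1
    ext i j
    fin_cases i <;> fin_cases j <;> simp [hP₃] <;> field_simp
  refine ⟨fun t => ?_, fun t => ?_, fun t => ?_, fun t => ?_⟩
  · convert one_add_smul_mem_unitsImage rfl hc h1 h1' h2 h3 hPP₁ hPP₂ ?_ hom₁ hom₂
      (t * (c - 1) ^ 3) using 1
    all_goals
      ext i j
      fin_cases i <;> fin_cases j <;> simp [hP₁, hP₂] <;> field_simp <;> ring_nf <;> simp
  · convert one_add_smul_mem_unitsImage rfl hc h1 h1' h2 h3 hPP₂ hPP₁ ?_ hom₂ hom₁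
      (-t * (c - 1) ^ 3 / c) using 1
    all_goals
      ext i j
      fin_cases i <;> fin_cases j <;> simp [hP₁, hP₂] <;> field_simp <;> ring_nf <;> simp
  · convert one_add_smul_mem_unitsImage rfl hc h1 h1' h2 h3 hPP₂ hPP₃ ?_ hom₂ hom₃
      (t * (c - 1) ^ 3) using 1
    all_goals
      ext i j
      fin_cases i <;> fin_cases j <;> simp [hP₂, hP₃] <;> field_simp <;> ring_nf <;> simp
  · convert one_add_smul_mem_unitsImage rfl hc h1 h1' h2 h3 hPP₃ hPP₂ ?_ hom₃ hom₂
      (-t * (c - 1) ^ 3 / c) using 1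
    all_goals
      ext i j
      fin_cases i <;> fin_cases j <;> simp [hP₂, hP₃] <;> field_simp <;> ring_nf <;> simp

/-- If `c` generates the multiplicative group and is not a root of unity of small order, then the
free subgroup of the Burau group contains `SL₃`. -/
theorem mem_burauFree_of_primitive [Finite F] (hgen : ∀ y : F, y ≠ 0 → ∃ n : ℕ, c ^ n = y)
    (h1 : c - 1 ≠ 0) (h1' : c + 1 ≠ 0) (h2 : c ^ 2 + 1 ≠ 0) (h3 : c ^ 3 - 1 ≠ 0)
    (hm : c ^ 2 - c + 1 ≠ 0) (M : Matrix (Fin 3) (Fin 3) F) (hM : M.det = 1) :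
    M ∈ (burauFree c hc).unitsImage := by
  obtain ⟨r12, r21, r23, r32⟩ := burau_transvections_mem c hc hgen h1 h1' h2 h3
  have hmc : (c ^ 2 - c + 1) ^ 2 - c ^ 2 ≠ 0 := by
    have : (c ^ 2 - c + 1) ^ 2 - c ^ 2 = (c - 1) ^ 2 * (c ^ 2 + 1) := by ring
    simp [this, h1, h2]
  generalize c ^ 2 - c + 1 = m at *
  obtain ⟨d, hd⟩ : ∃ d, d = m ^ 2 - c ^ 2 := ⟨_, rfl⟩
  rw [← hd] at hmc
  have h21 (t : F) : !![1, 0, 0; t, 1, 0; 0, 0, 1] ∈ (burauGroup c hc).unitsImage := by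
    convert mul_mem
      (r21 (t * m / d))
      (r23 (t / d)) using 1
    ext i j
    fin_cases i <;> fin_cases j <;> simp <;> field_simp <;> (try rw [hd]) <;> ring
  have h23 (t : F) : !![1, 0, 0; 0, 1, t; 0, 0, 1] ∈ (burauGroup c hc).unitsImage := by
    convert mul_mem
      (r21 (t * c ^ 2 / d))
      (r23 (t * m / d)) using 1
    ext i j
    fin_cases i <;> fin_cases j <;> simp <;> field_simp <;> (try rw [hd]) <;> ring
  refine mem_burauFree_of_elementary_mem c hc h1 h1' (fun t => ?_) (fun t => ?_) h21 h23 M hM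
  · refine mem_unitsImage_of_mul_eq (mul_mem (r12 1) (h23 (t / m)))
      (mul_mem (h23 (t / m)) (r12 1)) ?_
    ext i j
    fin_cases i <;> fin_cases j <;> simp <;> field_simp <;> ring
  · refine mem_unitsImage_of_mul_eq (mul_mem (r32 1) (h21 (t / m)))
      (mul_mem (h21 (t / m)) (r32 1)) ?_
    ext i j
    fin_cases i <;> fin_cases j <;> simp <;> field_simp <;> ring

end Matrix

namespace Matrix

open Subgroup

/-- In characteristic seven, a submonoid containing the three Burau matrices with parameter `-3`
contains the elementary matrices with indices `13`, `31`, `21` and `23`. -/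
theorem elementary_mem_of_burau_mem_zmod_seven
    {S : Submonoid (Matrix (Fin 3) (Fin 3) (ZMod 7))}
    (h₁ : !![3, 1, 0; 0, 1, 0; 0, 0, 1] ∈ S) (h₂ : !![1, 0, 0; -3, 3, 1; 0, 0, 1] ∈ S)
    (h₃ : !![1, 0, 0; 0, 1, 0; 0, -3, 3] ∈ S) (t : ZMod 7) :
    !![1, 0, t; 0, 1, 0; 0, 0, 1] ∈ S ∧ !![1, 0, 0; 0, 1, 0; t, 0, 1] ∈ S ∧
    !![1, 0, 0; t, 1, 0; 0, 0, 1] ∈ S ∧ !![1, 0, 0; 0, 1, t; 0, 0, 1] ∈ S := by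
  set s₁ : Matrix (Fin 3) (Fin 3) (ZMod 7) := !![3, 1, 0; 0, 1, 0; 0, 0, 1] with hs₁
  set s₂ : Matrix (Fin 3) (Fin 3) (ZMod 7) := !![1, 0, 0; -3, 3, 1; 0, 0, 1] with hs₂
  set s₃ : Matrix (Fin 3) (Fin 3) (ZMod 7) := !![1, 0, 0; 0, 1, 0; 0, -3, 3] with hs₃
  have e₁₃ : s₂ ^ 4 * s₁ ^ 5 * s₂ ^ 2 * s₁ ^ 4 * s₂ ^ 3 = !![1, 0, 1; 0, 1, 0; 0, 0, 1] := by
    decide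
  have e₃₁ : s₂ ^ 2 * s₃ ^ 4 * s₂ ^ 4 * s₃ ^ 3 * s₂ ^ 5 = !![1, 0, 0; 0, 1, 0; 1, 0, 1] := by
    decide
  have e₂₁ : s₃ ^ 3 * s₂ ^ 2 * s₃ ^ 4 * s₂ * s₃ ^ 2 = !![1, 0, 0; 1, 1, 0; 0, 0, 1] := by
    decide
  have e₂₃ : s₁ * s₂ ^ 3 * s₁ ^ 2 * s₂ ^ 2 * s₁ ^ 4 = !![1, 0, 0; 0, 1, 1; 0, 0, 1] := by
    decide
  have p₁₃ : ∀ t : ZMod 7, !![1, 0, 1; 0, 1, 0; 0, 0, 1] ^ t.val =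
      (!![1, 0, t; 0, 1, 0; 0, 0, 1] : Matrix (Fin 3) (Fin 3) (ZMod 7)) := by decide
  have p₃₁ : ∀ t : ZMod 7, !![1, 0, 0; 0, 1, 0; 1, 0, 1] ^ t.val =
      (!![1, 0, 0; 0, 1, 0; t, 0, 1] : Matrix (Fin 3) (Fin 3) (ZMod 7)) := by decide
  have p₂₁ : ∀ t : ZMod 7, !![1, 0, 0; 1, 1, 0; 0, 0, 1] ^ t.val =
      (!![1, 0, 0; t, 1, 0; 0, 0, 1] : Matrix (Fin 3) (Fin 3) (ZMod 7)) := by decide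
  have p₂₃ : ∀ t : ZMod 7, !![1, 0, 0; 0, 1, 1; 0, 0, 1] ^ t.val =
      (!![1, 0, 0; 0, 1, t; 0, 0, 1] : Matrix (Fin 3) (Fin 3) (ZMod 7)) := by decide
  rw [← p₁₃, ← p₃₁, ← p₂₁, ← p₂₃, ← e₁₃, ← e₃₁, ← e₂₁, ← e₂₃]
  have word (x y : Matrix (Fin 3) (Fin 3) (ZMod 7)) (hx : x ∈ S) (hy : y ∈ S) (a b d e f : ℕ) :
      x ^ a * y ^ b * x ^ d * y ^ e * x ^ f ∈ S :=
    mul_mem (mul_mem (mul_mem (mul_mem (pow_mem hx a) (pow_mem hy b)) (pow_mem hx d))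
      (pow_mem hy e)) (pow_mem hx f)
  refine ⟨pow_mem (word _ _ h₂ h₁ 4 5 2 4 3) _, pow_mem (word _ _ h₂ h₃ 2 4 4 3 5) _,
    pow_mem ?_ _, pow_mem ?_ _⟩
  · simpa using word _ _ h₃ h₂ 3 2 4 1 2
  · simpa using word _ _ h₁ h₂ 1 3 2 2 4

theorem natCast_ne_zero_of_card_eq_seven {F : Type*} [Field F] [Fintype F]
    (hF : Fintype.card F = 7) (n : ℕ) (hn : (n : ZMod 7) ≠ 0) : (n : F) ≠ 0 := by
  rw [← map_natCast (ZMod.ringEquivOfPrime F (by norm_num) hF)]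
  exact (map_ne_zero_iff _ (RingEquiv.injective _)).2 hn

theorem mem_burauFree_of_card_eq_seven {F : Type*} [Field F] [Fintype F]
    (hF : Fintype.card F = 7) (hc : (3 : F) ≠ 0) (M : Matrix (Fin 3) (Fin 3) F)
    (hM : M.det = 1) : M ∈ (burauFree (3 : F) hc).unitsImage := by
  let e : ZMod 7 ≃+* F := ZMod.ringEquivOfPrime F (by norm_num) hF
  have mem_comap (a b c d e' f g h i : ZMod 7) : !![a, b, c; d, e', f; g, h, i] ∈
      (burauGroup (3 : F) hc).unitsImage.comap e.toRingHom.mapMatrix.toMonoidHom ↔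
        !![e a, e b, e c; e d, e e', e f; e g, e h, e i] ∈ (burauGroup (3 : F) hc).unitsImage := by
    rw [Submonoid.mem_comap]
    apply iff_of_eq
    congr 1
    ext i j
    fin_cases i <;> fin_cases j <;> rfl
  have e3 : e 3 = 3 := map_ofNat e 3
  have elem := elementary_mem_of_burau_mem_zmod_seven
    (S := (burauGroup (3 : F) hc).unitsImage.comap e.toRingHom.mapMatrix.toMonoidHom)
    ((mem_comap ..).2 (by simpa [e3] using burau₁_mem (3 : F) hc))
    ((mem_comap ..).2 (by simpa [e3] using burau₂_mem (3 : F) hc))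
    ((mem_comap ..).2 (by simpa [e3] using burau₃_mem (3 : F) hc))
  simp only [mem_comap, map_zero, map_one] at elem
  have ne := natCast_ne_zero_of_card_eq_seven hF
  refine mem_burauFree_of_elementary_mem (3 : F) hc ?_ ?_ (fun t => ?_) (fun t => ?_)
    (fun t => ?_) (fun t => ?_) M hM
  · have := ne 2 (by decide)
    norm_num at this ⊢
    exact this
  · have := ne 4 (by decide)
    norm_num at this ⊢
    exact this
  · simpa using (elem (e.symm t)).1
  · simpa using (elem (e.symm t)).2.1
  · simpa using (elem (e.symm t)).2.2.1
  · simpa using (elem (e.symm t)).2.2.2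

end Matrix

namespace Matrix

open Subgroup

/-- Over a finite field with at least seven elements, for a suitable parameter the group
`burauFree` contains `SL₃` and the automorphisms inverting a free generator exist. -/
theorem exists_burau_parameter (F : Type*) [Field F] [Fintype F] (hF : 7 ≤ Fintype.card F) :
    ∃ (c : F) (hc : c ≠ 0), c ≠ 1 ∧ c ^ 2 + 1 ≠ 0 ∧
      ∀ M : Matrix (Fin 3) (Fin 3) F, M.det = 1 → M ∈ (burauFree c hc).unitsImage := by
  obtain hF | hF := hF.eq_or_lt
  · have ne := natCast_ne_zero_of_card_eq_seven hF.symm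
    have hc : (3 : F) ≠ 0 := by simpa using ne 3 (by decide)
    refine ⟨3, hc, sub_ne_zero.1 ?_, ?_, mem_burauFree_of_card_eq_seven hF.symm hc⟩
    · have := ne 2 (by decide)
      norm_num at this ⊢
      exact this
    · have := ne 10 (by decide)
      norm_num at this ⊢
      exact this
  · obtain ⟨g, hg⟩ := IsCyclic.exists_generator (α := Fˣ)
    have horder : orderOf g = Fintype.card F - 1 := by
      rw [orderOf_eq_card_of_forall_mem_zpowers hg, Nat.card_units, Nat.card_eq_fintype_card]
    have pow_ne (k : ℕ) (h0 : k ≠ 0) (hk : k < 7) : (g : F) ^ k ≠ 1 := by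
      rw [← Units.val_pow_eq_pow_val, Ne, Units.val_eq_one]
      exact pow_ne_one_of_lt_orderOf h0 (by omega)
    have h1 : (g : F) - 1 ≠ 0 := fun h => pow_ne 1 (by norm_num) (by norm_num)
      (by linear_combination h)
    have h2 : (g : F) ^ 2 + 1 ≠ 0 := fun h => pow_ne 4 (by norm_num) (by norm_num)
      (by linear_combination ((g : F) ^ 2 - 1) * h)
    refine ⟨g, g.ne_zero, sub_ne_zero.1 h1, h2, mem_burauFree_of_primitive (g : F) g.ne_zero
      (fun y hy => ?_) h1 (fun h => pow_ne 2 (by norm_num) (by norm_num) ?_) h2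
      (fun h => pow_ne 3 (by norm_num) (by norm_num) ?_)
      (fun h => pow_ne 6 (by norm_num) (by norm_num) ?_)⟩
    · obtain ⟨n, hn⟩ := mem_powers_iff_mem_zpowers.2 (hg (Units.mk0 y hy))
      exact ⟨n, by simpa using congrArg Units.val hn⟩
    · linear_combination ((g : F) - 1) * h
    · linear_combination h
    · linear_combination ((g : F) + 1) * ((g : F) ^ 3 - 1) * h

variable {F : Type*} [Field F] (c : F) (hc : c ≠ 0)

/-- The homomorphism from the free group to `SL₃` given by the Burau matrices. -/
def burauHom : FreeGroup (Fin 2) →* SpecialLinearGroup (Fin 3) F :=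
  FreeGroup.lift ![
    ⟨(burauA c hc).val, by rw [burauA_val]; simp [det_fin_three, hc]⟩,
    ⟨(burauB c hc).val, by
      rw [burauB_val, det_fin_three]
      simp
      field_simp
      ring⟩]

theorem toGL_comp_burauHom : SpecialLinearGroup.toGL.comp (burauHom c hc) =
    FreeGroup.lift ![burauA c hc, burauB c hc] := by
  ext i : 1
  fin_cases i <;> exact Units.ext (by simp [burauHom, SpecialLinearGroup.toGL])

theorem ker_burauHom :
    (burauHom c hc).ker = (FreeGroup.lift ![burauA c hc, burauB c hc]).ker := by
  rw [← toGL_comp_burauHom]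
  ext w
  rw [MonoidHom.mem_ker, MonoidHom.mem_ker, MonoidHom.comp_apply,
    map_eq_one_iff _ SpecialLinearGroup.toGL_injective]

theorem burauHom_surjective
    (h : ∀ M : Matrix (Fin 3) (Fin 3) F, M.det = 1 → M ∈ (burauFree c hc).unitsImage) :
    Function.Surjective (burauHom c hc) := by
  intro M
  obtain ⟨g, hg, hgM⟩ := h M.val M.2
  rw [burauFree, ← Matrix.range_cons_cons_empty _ _ ![], ← FreeGroup.range_lift_eq_closure,
    ← toGL_comp_burauHom] at hg
  obtain ⟨w, rfl⟩ := hg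
  exact ⟨w, Subtype.ext hgM⟩

end Matrix

/-- For every prime power `q ≥ 7` (i.e. for every finite field `F` with at least 7 elements),
the finite simple group `PSL₃(F_q)` is a characteristic quotient of `F₂`. -/
theorem psl3_is_characteristic_quotient (F : Type) [Field F] [Fintype F]
    (hF : 7 ≤ Fintype.card F) :
    IsCharacteristicQuotientOfF2
      (Matrix.SpecialLinearGroup (Fin 3) F ⧸
        Subgroup.center (Matrix.SpecialLinearGroup (Fin 3) F)) := by
  obtain ⟨c, hc, h1, h2, h⟩ := Matrix.exists_burau_parameter F hF
  have hψ := Matrix.burauHom_surjective c hc h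
  refine ⟨(QuotientGroup.mk' _).comp (Matrix.burauHom c hc),
    (QuotientGroup.mk'_surjective _).comp hψ,
    MonoidHom.ker_mk_center_comp_characteristic _ hψ ?_⟩
  rw [Matrix.ker_burauHom]
  exact Matrix.ker_lift_burau_characteristic c hc h1 h2
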